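/- arXiv:2507.06591 — 3 statements merged into one kernel-verified Lean document; each statement's English description precedes it below -/
import Mathlib

section
/- Let D be a Levi-Civita connection for g. Then at every point of U, D_{X1}X1 = (A/det𝒜)·(a12·X1 − a11·X2), where A = a11·c1 + a12·c2 and det𝒜 = a11·a22 − a12². -/
noncomputable section

/-- Points of the plane. -/
abbrev Pt : Type := ℝ × ℝ

/-- Vector fields on (an open subset of) the plane, given as maps `ℝ² → ℝ²`. -/
abbrev VF : Type := Pt → Pt

/-- The Lie bracket of vector fields: `[V,W](q) = DW(q)(V(q)) − DV(q)(W(q))`. -/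
def vbracket (V W : VF) : VF :=
  fun q => fderiv ℝ W q (V q) - fderiv ℝ V q (W q)

/-- Directional derivative of a function `f` along the vector field `X`. -/
def dirDeriv (X : VF) (f : Pt → ℝ) : Pt → ℝ :=
  fun q => fderiv ℝ f q (X q)

/-- `g` assigns to each point of `U` a symmetric bilinear form on `ℝ²`, smoothly in the point. -/
structure SmoothSymmBilin (U : Set Pt) (g : Pt → Pt → Pt → ℝ) : Prop where
  symm : ∀ q ∈ U, ∀ v w : Pt, g q v w = g q w v
  add_left : ∀ q ∈ U, ∀ u v w : Pt, g q (u + v) w = g q u w + g q v w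
  smul_left : ∀ q ∈ U, ∀ (r : ℝ) (v w : Pt), g q (r • v) w = r * g q v w
  add_right : ∀ q ∈ U, ∀ u v w : Pt, g q u (v + w) = g q u v + g q u w
  smul_right : ∀ q ∈ U, ∀ (r : ℝ) (v w : Pt), g q v (r • w) = r * g q v w
  smooth : ∀ v w : Pt, ContDiffOn ℝ (⊤ : ℕ∞) (fun q => g q v w) U

/-- A Levi-Civita connection for `g` on `U`: it sends pairs of smooth vector fields to a
smooth vector field, is `C^∞(U)`-linear in the first argument, `ℝ`-linear in the second,
satisfies the Leibniz rule, is torsion-free and metric-compatible. -/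
structure IsLeviCivita (U : Set Pt) (g : Pt → Pt → Pt → ℝ) (D : VF → VF → VF) : Prop where
  smooth : ∀ V W : VF, ContDiffOn ℝ (⊤ : ℕ∞) V U → ContDiffOn ℝ (⊤ : ℕ∞) W U →
    ContDiffOn ℝ (⊤ : ℕ∞) (D V W) U
  add_fst : ∀ V V' W : VF, ContDiffOn ℝ (⊤ : ℕ∞) V U → ContDiffOn ℝ (⊤ : ℕ∞) V' U →
    ContDiffOn ℝ (⊤ : ℕ∞) W U → ∀ q ∈ U, D (V + V') W q = D V W q + D V' W q
  smul_fst : ∀ (f : Pt → ℝ) (V W : VF), ContDiffOn ℝ (⊤ : ℕ∞) f U →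
    ContDiffOn ℝ (⊤ : ℕ∞) V U → ContDiffOn ℝ (⊤ : ℕ∞) W U →
    ∀ q ∈ U, D (fun p => f p • V p) W q = f q • D V W q
  add_snd : ∀ V W W' : VF, ContDiffOn ℝ (⊤ : ℕ∞) V U → ContDiffOn ℝ (⊤ : ℕ∞) W U →
    ContDiffOn ℝ (⊤ : ℕ∞) W' U → ∀ q ∈ U, D V (W + W') q = D V W q + D V W' q
  smul_snd : ∀ (r : ℝ) (V W : VF), ContDiffOn ℝ (⊤ : ℕ∞) V U →
    ContDiffOn ℝ (⊤ : ℕ∞) W U → ∀ q ∈ U, D V (r • W) q = r • D V W q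
  leibniz : ∀ (f : Pt → ℝ) (V W : VF), ContDiffOn ℝ (⊤ : ℕ∞) f U →
    ContDiffOn ℝ (⊤ : ℕ∞) V U → ContDiffOn ℝ (⊤ : ℕ∞) W U →
    ∀ q ∈ U, D V (fun p => f p • W p) q = fderiv ℝ f q (V q) • W q + f q • D V W q
  torsion_free : ∀ V W : VF, ContDiffOn ℝ (⊤ : ℕ∞) V U → ContDiffOn ℝ (⊤ : ℕ∞) W U →
    ∀ q ∈ U, D V W q - D W V q = vbracket V W q
  compat : ∀ X V W : VF, ContDiffOn ℝ (⊤ : ℕ∞) X U → ContDiffOn ℝ (⊤ : ℕ∞) V U →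
    ContDiffOn ℝ (⊤ : ℕ∞) W U →
    ∀ q ∈ U, fderiv ℝ (fun p => g p (V p) (W p)) q (X q)
      = g q (D X V q) (W q) + g q (V q) (D X W q)

/-- A function constant on an open set has zero derivative there. -/
theorem fderiv_eq_zero_of_eqOn_const {U : Set Pt} (hU : IsOpen U) {f : Pt → ℝ} {a : ℝ}
    (hf : ∀ q ∈ U, f q = a) {q : Pt} (hq : q ∈ U) : fderiv ℝ f q = 0 := by
  have h : f =ᶠ[nhds q] fun _ => a := Filter.eventually_of_mem (hU.mem_nhds hq) hf
  rw [h.fderiv_eq, fderiv_fun_const]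
  rfl

/-- Two linearly independent vectors span the plane. -/
theorem exists_eq_smul_add_smul {v w : Pt} (h : LinearIndependent ℝ ![v, w]) (u : Pt) :
    ∃ x y : ℝ, u = x • v + y • w := by
  have hs := h.span_eq_top_of_card_eq_finrank' (by simp)
  have hu : u ∈ Submodule.span ℝ (Set.range ![v, w]) := hs ▸ Submodule.mem_top
  rw [Matrix.range_cons, Matrix.range_cons, Matrix.range_empty, Set.union_empty,
    Set.singleton_union, Submodule.mem_span_pair] at hu
  obtain ⟨x, y, hxy⟩ := hu
  exact ⟨x, y, hxy.symm⟩

theorem covariant_derivative_D_X1_X1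
    (U : Set Pt) (hU : IsOpen U)
    (X1 X2 : VF)
    (hX1 : ContDiffOn ℝ (⊤ : ℕ∞) X1 U) (hX2 : ContDiffOn ℝ (⊤ : ℕ∞) X2 U)
    (hbasis : ∀ q ∈ U, LinearIndependent ℝ ![X1 q, X2 q])
    (g : Pt → Pt → Pt → ℝ) (hg : SmoothSymmBilin U g)
    (a11 a12 a22 : ℝ)
    (h11 : ∀ q ∈ U, g q (X1 q) (X1 q) = a11)
    (h22 : ∀ q ∈ U, g q (X2 q) (X2 q) = a22)
    (h12 : ∀ q ∈ U, g q (X1 q) (X2 q) = a12)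
    (hnd : a11 * a22 - a12 ^ 2 ≠ 0)
    (c1 c2 : Pt → ℝ)
    (hc1 : ContDiffOn ℝ (⊤ : ℕ∞) c1 U) (hc2 : ContDiffOn ℝ (⊤ : ℕ∞) c2 U)
    (hc : ∀ q ∈ U, vbracket X1 X2 q = c1 q • X1 q + c2 q • X2 q)
    (D : VF → VF → VF) (hD : IsLeviCivita U g D)
    :
    ∀ q ∈ U, D X1 X1 q = ((a11 * c1 q + a12 * c2 q) / (a11 * a22 - a12 ^ 2)) • (a12 • X1 q - a11 • X2 q) := by
  intro q hq
  have compat_zero : ∀ X V W : VF, ContDiffOn ℝ (⊤ : ℕ∞) X U → ContDiffOn ℝ (⊤ : ℕ∞) V U →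
      ContDiffOn ℝ (⊤ : ℕ∞) W U → ∀ a : ℝ, (∀ p ∈ U, g p (V p) (W p) = a) →
      g q (D X V q) (W q) + g q (V q) (D X W q) = 0 := by
    intro X V W hX hV hW a ha
    rw [← hD.compat X V W hX hV hW q hq, fderiv_eq_zero_of_eqOn_const hU ha hq]
    rfl
  have h111 := compat_zero X1 X1 X1 hX1 hX1 hX1 a11 h11
  have h211 := compat_zero X2 X1 X1 hX2 hX1 hX1 a11 h11
  have h112 := compat_zero X1 X1 X2 hX1 hX1 hX2 a12 h12
  have htor : D X1 X2 q = D X2 X1 q + (c1 q • X1 q + c2 q • X2 q) := by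
    rw [← hc q hq, ← hD.torsion_free X1 X2 hX1 hX2 q hq]
    abel
  have h21 : g q (X2 q) (X1 q) = a12 := (hg.symm q hq _ _).trans (h12 q hq)
  rw [htor, hg.add_right q hq, hg.add_right q hq, hg.smul_right q hq, hg.smul_right q hq,
    h11 q hq, h12 q hq] at h112
  rw [hg.symm q hq (D X2 X1 q)] at h211
  rw [hg.symm q hq (X1 q)] at h111
  obtain ⟨x, y, hxy⟩ := exists_eq_smul_add_smul (hbasis q hq) (D X1 X1 q)
  rw [hxy] at h111 h112 ⊢
  simp only [hg.add_left q hq, hg.smul_left q hq, h11 q hq, h12 q hq, h22 q hq, h21]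
    at h111 h112
  have hx : x = (a11 * c1 q + a12 * c2 q) / (a11 * a22 - a12 ^ 2) * a12 := by
    rw [div_mul_eq_mul_div, eq_div_iff hnd]
    linear_combination a22 / 2 * h111 - a12 * h112 + a12 / 2 * h211
  have hy : y = -((a11 * c1 q + a12 * c2 q) / (a11 * a22 - a12 ^ 2) * a11) := by
    rw [div_mul_eq_mul_div, ← neg_div, eq_div_iff hnd]
    linear_combination a11 * h112 - a12 / 2 * h111 - a11 / 2 * h211
  rw [hx, hy]
  module
end
end

section
/- Let D be a Levi-Civita connection for g. Then at every point of U, D_{X1}X2 = (A/det𝒜)·(a22·X1 − a12·X2), where A = a11·c1 + a12·c2 and det𝒜 = a11·a22 − a12². -/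
noncomputable section

/-- Two linearly independent vectors of the plane span it. -/
lemma exists_smul_add_smul_eq {v w : Pt} (h : LinearIndependent ℝ ![v, w]) (u : Pt) :
    ∃ a b : ℝ, a • v + b • w = u := by
  have hspan := h.span_eq_top_of_card_eq_finrank' (by simp)
  rw [Matrix.range_cons_cons_empty] at hspan
  exact Submodule.mem_span_pair.mp (hspan ▸ Submodule.mem_top)

/-- If `g(V, W)` is constant on the open set `U`, metric compatibility says that
`g(D_X V, W) + g(V, D_X W) = 0` on `U`. -/
lemma IsLeviCivita.compat_of_const {U : Set Pt} (hU : IsOpen U) {g : Pt → Pt → Pt → ℝ}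
    {D : VF → VF → VF} (hD : IsLeviCivita U g D) {X V W : VF}
    (hX : ContDiffOn ℝ (⊤ : ℕ∞) X U) (hV : ContDiffOn ℝ (⊤ : ℕ∞) V U)
    (hW : ContDiffOn ℝ (⊤ : ℕ∞) W U) {a : ℝ} (ha : ∀ q ∈ U, g q (V q) (W q) = a)
    {q : Pt} (hq : q ∈ U) :
    g q (D X V q) (W q) + g q (V q) (D X W q) = 0 := by
  have hconst : (fun p => g p (V p) (W p)) =ᶠ[nhds q] fun _ => a :=
    Filter.eventually_of_mem (hU.mem_nhds hq) ha
  rw [← hD.compat X V W hX hV hW q hq, hconst.fderiv_eq]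
  simp

/-- If `g(V, V)` is constant on the open set `U`, then `g(D_X V, V) = 0` on `U`. -/
lemma IsLeviCivita.apply_self_eq_zero {U : Set Pt} (hU : IsOpen U) {g : Pt → Pt → Pt → ℝ}
    (hg : SmoothSymmBilin U g) {D : VF → VF → VF} (hD : IsLeviCivita U g D) {X V : VF}
    (hX : ContDiffOn ℝ (⊤ : ℕ∞) X U) (hV : ContDiffOn ℝ (⊤ : ℕ∞) V U)
    {a : ℝ} (ha : ∀ q ∈ U, g q (V q) (V q) = a) {q : Pt} (hq : q ∈ U) :
    g q (D X V q) (V q) = 0 := by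
  have h := hD.compat_of_const hU hX hV hV ha hq
  rw [hg.symm q hq (V q)] at h
  linarith

theorem covariant_derivative_D_X1_X2
    (U : Set Pt) (hU : IsOpen U)
    (X1 X2 : VF)
    (hX1 : ContDiffOn ℝ (⊤ : ℕ∞) X1 U) (hX2 : ContDiffOn ℝ (⊤ : ℕ∞) X2 U)
    (hbasis : ∀ q ∈ U, LinearIndependent ℝ ![X1 q, X2 q])
    (g : Pt → Pt → Pt → ℝ) (hg : SmoothSymmBilin U g)
    (a11 a12 a22 : ℝ)
    (h11 : ∀ q ∈ U, g q (X1 q) (X1 q) = a11)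
    (h22 : ∀ q ∈ U, g q (X2 q) (X2 q) = a22)
    (h12 : ∀ q ∈ U, g q (X1 q) (X2 q) = a12)
    (hnd : a11 * a22 - a12 ^ 2 ≠ 0)
    (c1 c2 : Pt → ℝ)
    (hc1 : ContDiffOn ℝ (⊤ : ℕ∞) c1 U) (hc2 : ContDiffOn ℝ (⊤ : ℕ∞) c2 U)
    (hc : ∀ q ∈ U, vbracket X1 X2 q = c1 q • X1 q + c2 q • X2 q)
    (D : VF → VF → VF) (hD : IsLeviCivita U g D)
    :
    ∀ q ∈ U, D X1 X2 q = ((a11 * c1 q + a12 * c2 q) / (a11 * a22 - a12 ^ 2)) • (a22 • X1 q - a12 • X2 q) := by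
  intro q hq
  have hv2 : g q (D X1 X2 q) (X2 q) = 0 := hD.apply_self_eq_zero hU hg hX1 hX2 h22 hq
  have hv1 : g q (D X1 X2 q) (X1 q) = a11 * c1 q + a12 * c2 q := by
    have htor : D X1 X2 q = D X2 X1 q + (c1 q • X1 q + c2 q • X2 q) := by
      rw [← hc q hq, ← hD.torsion_free X1 X2 hX1 hX2 q hq, add_sub_cancel]
    rw [htor, hg.add_left q hq, hD.apply_self_eq_zero hU hg hX2 hX1 h11 hq, hg.add_left q hq,
      hg.smul_left q hq, hg.smul_left q hq, h11 q hq, hg.symm q hq (X2 q), h12 q hq]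
    ring
  obtain ⟨α, β, hαβ⟩ := exists_smul_add_smul_eq (hbasis q hq) (D X1 X2 q)
  rw [← hαβ, hg.add_left q hq, hg.smul_left q hq, hg.smul_left q hq] at hv1 hv2
  rw [h11 q hq, hg.symm q hq (X2 q), h12 q hq] at hv1
  rw [h12 q hq, h22 q hq] at hv2
  have hα : α = (a11 * c1 q + a12 * c2 q) / (a11 * a22 - a12 ^ 2) * a22 := by
    rw [div_mul_eq_mul_div, eq_div_iff hnd]
    linear_combination a22 * hv1 - a12 * hv2
  have hβ : β = -((a11 * c1 q + a12 * c2 q) / (a11 * a22 - a12 ^ 2) * a12) := by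
    rw [div_mul_eq_mul_div, ← neg_div, eq_div_iff hnd]
    linear_combination a11 * hv2 - a12 * hv1
  rw [← hαβ, hα, hβ, smul_sub, smul_smul, smul_smul, neg_smul, ← sub_eq_add_neg]
end
end

section
/- Let D be a Levi-Civita connection for g and let R_{XY}Z = D_{[X,Y]}Z − D_X D_Y Z + D_Y D_X Z. Then at every point of U, R_{X1 X2}X1 = (1/det𝒜)·(ξ1·X1 + ξ2·X2), where det𝒜 = a11·a22 − a12², A = a11·c1 + a12·c2, B = a12·c1 + a22·c2, ξ1 = a12·[(c1·A + c2·B) − (X1 B) + (X2 A)], ξ2 = a11·[−(c1·A + c2·B) + (X1 B) − (X2 A)], and X_i f denotes the directional derivative of the function f along X_i. -/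
noncomputable section

open Topology in
/-- A function that is constant on an open set has vanishing derivative there. -/
theorem fderiv_eq_zero_of_constOn {U : Set Pt} (hU : IsOpen U) {f : Pt → ℝ} {c : ℝ}
    (hf : ∀ q ∈ U, f q = c) {q : Pt} (hq : q ∈ U) : fderiv ℝ f q = 0 := by
  have h : f =ᶠ[𝓝 q] fun _ => c := by
    filter_upwards [hU.mem_nhds hq] with p hp using hf p hp
  rw [h.fderiv_eq, fderiv_fun_const]
  rfl

theorem contDiffOn_vbracket {U : Set Pt} (hU : IsOpen U) {V W : VF}
    (hV : ContDiffOn ℝ (⊤ : ℕ∞) V U) (hW : ContDiffOn ℝ (⊤ : ℕ∞) W U) :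
    ContDiffOn ℝ (⊤ : ℕ∞) (vbracket V W) U :=
  ((hW.fderiv_of_isOpen hU (by simp)).clm_apply hV).sub
    ((hV.fderiv_of_isOpen hU (by simp)).clm_apply hW)

namespace IsLeviCivita

variable {U : Set Pt} {g : Pt → Pt → Pt → ℝ} {D : VF → VF → VF}

theorem congr_fst (hD : IsLeviCivita U g D) {V V' W : VF}
    (hV : ContDiffOn ℝ (⊤ : ℕ∞) V U) (hV' : ContDiffOn ℝ (⊤ : ℕ∞) V' U)
    (hW : ContDiffOn ℝ (⊤ : ℕ∞) W U) (h : ∀ q ∈ U, V q = V' q) {q : Pt} (hq : q ∈ U) :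
    D V W q = D V' W q := by
  have hf : ContDiffOn ℝ (⊤ : ℕ∞) (U.indicator fun _ => (1 : ℝ)) U :=
    contDiffOn_const.congr fun p hp => Set.indicator_of_mem hp _
  have hfV : (fun p => U.indicator (fun _ => (1 : ℝ)) p • V p) =
      fun p => U.indicator (fun _ => (1 : ℝ)) p • V' p := by
    funext p
    by_cases hp : p ∈ U <;> simp [hp, h]
  have h1 := hD.smul_fst _ V W hf hV hW q hq
  have h2 := hD.smul_fst _ V' W hf hV' hW q hq
  rw [hfV, h2] at h1
  simpa [hq] using h1.symm

theorem congr_snd (hD : IsLeviCivita U g D) (hU : IsOpen U) {V W W' : VF}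
    (hV : ContDiffOn ℝ (⊤ : ℕ∞) V U) (hW : ContDiffOn ℝ (⊤ : ℕ∞) W U)
    (hW' : ContDiffOn ℝ (⊤ : ℕ∞) W' U) (h : ∀ q ∈ U, W q = W' q) {q : Pt} (hq : q ∈ U) :
    D V W q = D V W' q := by
  have hone : ∀ p ∈ U, U.indicator (fun _ => (1 : ℝ)) p = 1 :=
    fun p hp => Set.indicator_of_mem hp _
  have hf : ContDiffOn ℝ (⊤ : ℕ∞) (U.indicator fun _ => (1 : ℝ)) U :=
    contDiffOn_const.congr hone
  have hfW : (fun p => U.indicator (fun _ => (1 : ℝ)) p • W p) =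
      fun p => U.indicator (fun _ => (1 : ℝ)) p • W' p := by
    funext p
    by_cases hp : p ∈ U <;> simp [hp, h]
  have h1 := hD.leibniz _ V W hf hV hW q hq
  have h2 := hD.leibniz _ V W' hf hV hW' q hq
  rw [hfW, h2, fderiv_eq_zero_of_constOn hU hone hq] at h1
  simpa [hq] using h1.symm

theorem linearComb_fst (hD : IsLeviCivita U g D) {f₁ f₂ : Pt → ℝ} {V₁ V₂ W : VF}
    (hf₁ : ContDiffOn ℝ (⊤ : ℕ∞) f₁ U) (hf₂ : ContDiffOn ℝ (⊤ : ℕ∞) f₂ U)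
    (hV₁ : ContDiffOn ℝ (⊤ : ℕ∞) V₁ U) (hV₂ : ContDiffOn ℝ (⊤ : ℕ∞) V₂ U)
    (hW : ContDiffOn ℝ (⊤ : ℕ∞) W U) {q : Pt} (hq : q ∈ U) :
    D (fun p => f₁ p • V₁ p + f₂ p • V₂ p) W q = f₁ q • D V₁ W q + f₂ q • D V₂ W q := by
  rw [← hD.smul_fst f₁ V₁ W hf₁ hV₁ hW q hq, ← hD.smul_fst f₂ V₂ W hf₂ hV₂ hW q hq]
  exact hD.add_fst _ _ W (hf₁.smul hV₁) (hf₂.smul hV₂) hW q hq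

theorem linearComb_snd (hD : IsLeviCivita U g D) (r₁ r₂ : ℝ) {V W₁ W₂ : VF}
    (hV : ContDiffOn ℝ (⊤ : ℕ∞) V U) (hW₁ : ContDiffOn ℝ (⊤ : ℕ∞) W₁ U)
    (hW₂ : ContDiffOn ℝ (⊤ : ℕ∞) W₂ U) {q : Pt} (hq : q ∈ U) :
    D V (fun p => r₁ • W₁ p + r₂ • W₂ p) q = r₁ • D V W₁ q + r₂ • D V W₂ q := by
  rw [← hD.smul_snd r₁ V W₁ hV hW₁ q hq, ← hD.smul_snd r₂ V W₂ hV hW₂ q hq]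
  exact hD.add_snd V _ _ hV (hW₁.const_smul r₁) (hW₂.const_smul r₂) q hq

theorem inner_add_inner_eq_zero (hD : IsLeviCivita U g D) (hU : IsOpen U) {X V W : VF}
    (hX : ContDiffOn ℝ (⊤ : ℕ∞) X U) (hV : ContDiffOn ℝ (⊤ : ℕ∞) V U)
    (hW : ContDiffOn ℝ (⊤ : ℕ∞) W U) {a : ℝ} (h : ∀ q ∈ U, g q (V q) (W q) = a)
    {q : Pt} (hq : q ∈ U) : g q (D X V q) (W q) + g q (V q) (D X W q) = 0 := by
  rw [← hD.compat X V W hX hV hW q hq, fderiv_eq_zero_of_constOn hU h hq]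
  rfl

end IsLeviCivita

/-- Cramer's rule: a vector is determined by its products with the members of a frame. -/
theorem SmoothSymmBilin.eq_of_inner_frame {U : Set Pt} {g : Pt → Pt → Pt → ℝ}
    (hg : SmoothSymmBilin U g) {q : Pt} (hq : q ∈ U) {x₁ x₂ : Pt}
    (hx : LinearIndependent ℝ ![x₁, x₂]) {a11 a12 a22 : ℝ} (h11 : g q x₁ x₁ = a11)
    (h22 : g q x₂ x₂ = a22) (h12 : g q x₁ x₂ = a12) (hnd : a11 * a22 - a12 ^ 2 ≠ 0)
    {v : Pt} {α β : ℝ} (h1 : g q v x₁ = α) (h2 : g q v x₂ = β) :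
    v = (a11 * a22 - a12 ^ 2)⁻¹ •
      ((α * a22 - β * a12) • x₁ + (β * a11 - α * a12) • x₂) := by
  have hspan := hx.span_eq_top_of_card_eq_finrank' (by simp)
  have hv : v ∈ Submodule.span ℝ {x₁, x₂} := by
    have : Set.range ![x₁, x₂] = {x₁, x₂} := by simp [Set.pair_comm]
    rw [← this, hspan]
    trivial
  obtain ⟨s, t, rfl⟩ := Submodule.mem_span_pair.mp hv
  have h21 : g q x₂ x₁ = a12 := by rw [hg.symm q hq, h12]
  simp only [hg.add_left q hq, hg.smul_left q hq, h11, h22, h12, h21] at h1 h2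
  rw [eq_inv_smul_iff₀ hnd, ← h1, ← h2]
  module

theorem curvature_tensor_formula
    (U : Set Pt) (hU : IsOpen U)
    (X1 X2 : VF)
    (hX1 : ContDiffOn ℝ (⊤ : ℕ∞) X1 U) (hX2 : ContDiffOn ℝ (⊤ : ℕ∞) X2 U)
    (hbasis : ∀ q ∈ U, LinearIndependent ℝ ![X1 q, X2 q])
    (g : Pt → Pt → Pt → ℝ) (hg : SmoothSymmBilin U g)
    (a11 a12 a22 : ℝ)
    (h11 : ∀ q ∈ U, g q (X1 q) (X1 q) = a11)
    (h22 : ∀ q ∈ U, g q (X2 q) (X2 q) = a22)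
    (h12 : ∀ q ∈ U, g q (X1 q) (X2 q) = a12)
    (hnd : a11 * a22 - a12 ^ 2 ≠ 0)
    (c1 c2 : Pt → ℝ)
    (hc1 : ContDiffOn ℝ (⊤ : ℕ∞) c1 U) (hc2 : ContDiffOn ℝ (⊤ : ℕ∞) c2 U)
    (hc : ∀ q ∈ U, vbracket X1 X2 q = c1 q • X1 q + c2 q • X2 q)
    (D : VF → VF → VF) (hD : IsLeviCivita U g D)
    (A B : Pt → ℝ)
    (hA : ∀ p : Pt, A p = a11 * c1 p + a12 * c2 p)
    (hB : ∀ p : Pt, B p = a12 * c1 p + a22 * c2 p)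
    (ξ1 ξ2 : Pt → ℝ)
    (hξ1 : ∀ p : Pt, ξ1 p =
      a12 * ((c1 p * A p + c2 p * B p) - dirDeriv X1 B p + dirDeriv X2 A p))
    (hξ2 : ∀ p : Pt, ξ2 p =
      a11 * (-(c1 p * A p + c2 p * B p) + dirDeriv X1 B p - dirDeriv X2 A p))
    (R : VF)
    (hR : ∀ q : Pt, R q =
      D (vbracket X1 X2) X1 q - D X1 (D X2 X1) q + D X2 (D X1 X1) q)
    :
    ∀ q ∈ U, R q =
      ((a11 * a22 - a12 ^ 2)⁻¹) • (ξ1 q • X1 q + ξ2 q • X2 q) := by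
  have hA' : A = fun p => a11 * c1 p + a12 * c2 p := funext hA
  have hB' : B = fun p => a12 * c1 p + a22 * c2 p := funext hB
  have hAs : ContDiffOn ℝ (⊤ : ℕ∞) A U := by
    rw [hA']; exact (contDiffOn_const.mul hc1).add (contDiffOn_const.mul hc2)
  have hBs : ContDiffOn ℝ (⊤ : ℕ∞) B U := by
    rw [hB']; exact (contDiffOn_const.mul hc1).add (contDiffOn_const.mul hc2)
  have h21 : ∀ q ∈ U, g q (X2 q) (X1 q) = a12 := fun q hq => by rw [hg.symm q hq, h12 q hq]
  set Δ := a11 * a22 - a12 ^ 2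
  let J : VF := fun p => (-a12) • X1 p + a11 • X2 p
  have hJ : ContDiffOn ℝ (⊤ : ℕ∞) J U := (hX1.const_smul (-a12)).add (hX2.const_smul a11)
  have hDX : ∀ q ∈ U,
      D X1 X1 q = (-Δ⁻¹ * A q) • J q ∧
      D X2 X1 q = (-Δ⁻¹ * B q) • J q ∧
      D X1 X2 q = (Δ⁻¹ * A q) • (a22 • X1 q - a12 • X2 q) ∧
      D X2 X2 q = (Δ⁻¹ * B q) • (a22 • X1 q - a12 • X2 q) := by
    intro q hq
    have e111 := hD.inner_add_inner_eq_zero hU hX1 hX1 hX1 h11 hq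
    have e122 := hD.inner_add_inner_eq_zero hU hX1 hX2 hX2 h22 hq
    have e112 := hD.inner_add_inner_eq_zero hU hX1 hX1 hX2 h12 hq
    have e211 := hD.inner_add_inner_eq_zero hU hX2 hX1 hX1 h11 hq
    have e222 := hD.inner_add_inner_eq_zero hU hX2 hX2 hX2 h22 hq
    have e212 := hD.inner_add_inner_eq_zero hU hX2 hX1 hX2 h12 hq
    rw [hg.symm q hq (X1 q)] at e111 e112 e211 e212
    rw [hg.symm q hq (X2 q)] at e122 e222
    have htor : D X1 X2 q = D X2 X1 q + (c1 q • X1 q + c2 q • X2 q) := by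
      rw [← hc q hq, ← hD.torsion_free X1 X2 hX1 hX2 q hq]
      abel
    have t1 := congrArg (fun v => g q v (X1 q)) htor
    have t2 := congrArg (fun v => g q v (X2 q)) htor
    simp only [hg.add_left q hq, hg.smul_left q hq, h11 q hq, h12 q hq, h21 q hq,
      h22 q hq] at t1 t2
    have hAq := hA q
    have hBq := hB q
    have frame : ∀ {v : Pt} {α β : ℝ}, g q v (X1 q) = α → g q v (X2 q) = β → _ :=
      hg.eq_of_inner_frame hq (hbasis q hq) (h11 q hq) (h22 q hq) (h12 q hq) hnd
    refine ⟨?_, ?_, ?_, ?_⟩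
    · rw [frame (v := D X1 X1 q) (α := 0) (β := -A q) (by linarith) (by linarith)]
      module
    · rw [frame (v := D X2 X1 q) (α := 0) (β := -B q) (by linarith) (by linarith)]
      module
    · rw [frame (v := D X1 X2 q) (α := A q) (β := 0) (by linarith) (by linarith)]
      module
    · rw [frame (v := D X2 X2 q) (α := B q) (β := 0) (by linarith) (by linarith)]
      module
  have hDsmul : ∀ {V : VF} {f : Pt → ℝ}, ContDiffOn ℝ (⊤ : ℕ∞) V U →
      ContDiffOn ℝ (⊤ : ℕ∞) f U → ∀ q ∈ U, D V (fun p => (-Δ⁻¹ * f p) • J p) q =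
        (-Δ⁻¹ * dirDeriv V f q) • J q +
          (-Δ⁻¹ * f q) • ((-a12) • D V X1 q + a11 • D V X2 q) := by
    intro V f hV hf q hq
    have hfq : DifferentiableAt ℝ f q :=
      (hf.contDiffAt (hU.mem_nhds hq)).differentiableAt (by simp)
    rw [hD.leibniz _ V J (contDiffOn_const.mul hf) hV hJ q hq, fderiv_const_mul hfq,
      hD.linearComb_snd (-a12) a11 hV hX1 hX2 hq]
    rfl
  intro q hq
  have hbr : D (vbracket X1 X2) X1 q = c1 q • D X1 X1 q + c2 q • D X2 X1 q := by
    rw [hD.congr_fst (contDiffOn_vbracket hU hX1 hX2) ((hc1.smul hX1).add (hc2.smul hX2)) hX1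
      hc hq]
    exact hD.linearComb_fst hc1 hc2 hX1 hX2 hX1 hq
  have h121 : D X1 (D X2 X1) q = D X1 (fun p => (-Δ⁻¹ * B p) • J p) q :=
    hD.congr_snd hU hX1 (hD.smooth X2 X1 hX2 hX1) ((contDiffOn_const.mul hBs).smul hJ)
      (fun p hp => (hDX p hp).2.1) hq
  have h211 : D X2 (D X1 X1) q = D X2 (fun p => (-Δ⁻¹ * A p) • J p) q :=
    hD.congr_snd hU hX2 (hD.smooth X1 X1 hX1 hX1) ((contDiffOn_const.mul hAs).smul hJ)
      (fun p hp => (hDX p hp).1) hq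
  obtain ⟨d11, d21, d12, d22⟩ := hDX q hq
  rw [hR, hbr, h121, h211, hDsmul hX1 hBs q hq, hDsmul hX2 hAs q hq, d11, d21, d12, d22, hξ1, hξ2]
  simp only [J]
  module
end
end
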